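/- Let ν ∈ ℝ and fix −ν < β₃ < β₂. For β₁ > β₂ let s² := (β₁+ν)(β₂−β₃)/((β₂+ν)(β₁−β₃)), ρ := (β₂−β₃)/(β₂+ν), and define the third characteristic speed of the Camassa–Holm–Whitham system C₃(β₁,β₂,β₃) := β₁+β₂+β₃+2ν + 2(β₃+ν)(β₃−β₂)Λ(s,ρ)/((β₂+ν)(K(s)−E(s))). Then C₃(β₁,β₂,β₃) → 3β₃ + 2ν as β₁ → β₂⁺; that is, at the coalescence β₁ = β₂ the Whitham equation for β₃ reduces to the Hopf equation ∂_t u + (3u+2ν)∂_x u = 0. -/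

import Mathlib

open Real intervalIntegral Filter Topology

/-- Complete elliptic integral of the first kind. -/
noncomputable def ellK (s : ℝ) : ℝ :=
  ∫ z in (0:ℝ)..1, 1 / Real.sqrt ((1 - z ^ 2) * (1 - s ^ 2 * z ^ 2))

/-- Complete elliptic integral of the second kind. -/
noncomputable def ellE (s : ℝ) : ℝ :=
  ∫ z in (0:ℝ)..1, Real.sqrt (1 - s ^ 2 * z ^ 2) / Real.sqrt (1 - z ^ 2)

/-- Complete elliptic integral of the third kind. -/
noncomputable def ellΛ (s ρ : ℝ) : ℝ :=
  ∫ z in (0:ℝ)..1,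
    1 / ((1 - ρ * z ^ 2) * Real.sqrt ((1 - z ^ 2) * (1 - s ^ 2 * z ^ 2)))

/-- Third characteristic speed of the Camassa–Holm–Whitham system. -/
noncomputable def whithamC₃ (ν β₁ β₂ β₃ : ℝ) : ℝ :=
  let s : ℝ := Real.sqrt ((β₁ + ν) * (β₂ - β₃) / ((β₂ + ν) * (β₁ - β₃)))
  let ρ : ℝ := (β₂ - β₃) / (β₂ + ν)
  β₁ + β₂ + β₃ + 2 * ν
    + 2 * (β₃ + ν) * (β₃ - β₂) * ellΛ s ρ / ((β₂ + ν) * (ellK s - ellE s))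

theorem intervalIntegrable_one_div_sqrt_one_sub_sq :
    IntervalIntegrable (fun z : ℝ => 1 / √(1 - z ^ 2)) MeasureTheory.volume 0 1 := by
  refine intervalIntegrable_deriv_of_nonneg (g := Real.arcsin)
    Real.continuous_arcsin.continuousOn (fun x hx => ?_) (fun x _ => by positivity)
  simp only [zero_le_one, inf_of_le_left, sup_of_le_right, Set.mem_Ioo] at hx
  exact Real.hasDerivAt_arcsin (by linarith) hx.2.ne

theorem one_sub_sq_le_one_sub_sq_mul_sq {s z : ℝ} (hz : z ∈ Set.Icc (0 : ℝ) 1) :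
    1 - s ^ 2 ≤ 1 - s ^ 2 * z ^ 2 := by
  have hz2 : z ^ 2 ≤ 1 := pow_le_one₀ hz.1 hz.2
  nlinarith [mul_nonneg (sq_nonneg s) (sub_nonneg.2 hz2)]

theorem intervalIntegrable_ellK_integrand {s : ℝ} (hs : s ^ 2 < 1) :
    IntervalIntegrable (fun z : ℝ => 1 / √((1 - z ^ 2) * (1 - s ^ 2 * z ^ 2)))
      MeasureTheory.volume 0 1 := by
  refine (intervalIntegrable_one_div_sqrt_one_sub_sq.const_mul (1 / √(1 - s ^ 2))).mono_fun
    (Measurable.aestronglyMeasurable (by fun_prop)) ?_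
  refine (MeasureTheory.ae_restrict_iff' measurableSet_uIoc).2 (.of_forall fun z hz => ?_)
  rw [Set.uIoc_of_le zero_le_one] at hz
  have hz2 : z ^ 2 ≤ 1 := pow_le_one₀ hz.1.le hz.2
  have hsz := one_sub_sq_le_one_sub_sq_mul_sq (s := s) (Set.Ioc_subset_Icc_self hz)
  beta_reduce
  have hpos : 0 < √(1 - s ^ 2) := Real.sqrt_pos.2 (by linarith)
  rw [Real.norm_of_nonneg (by positivity), Real.norm_of_nonneg (by positivity),
    Real.sqrt_mul (by linarith), mul_comm (√(1 - z ^ 2)), one_div_mul_one_div_rev, mul_comm,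
    ← one_div_mul_one_div_rev, ← one_div_mul_one_div_rev]
  gcongr

theorem abs_ellE_le (s : ℝ) :
    |ellE s| ≤ ∫ z in (0 : ℝ)..1, 1 / √(1 - z ^ 2) := by
  rw [ellE, ← Real.norm_eq_abs]
  refine norm_integral_le_of_norm_le zero_le_one (.of_forall fun z _ => ?_)
    intervalIntegrable_one_div_sqrt_one_sub_sq
  rw [Real.norm_of_nonneg (by positivity)]
  gcongr
  exact Real.sqrt_le_one.2 (by nlinarith [mul_nonneg (sq_nonneg s) (sq_nonneg z)])

theorem one_sub_mul_sq_ge {ρ z : ℝ} (hρ0 : 0 ≤ ρ) (hz : z ∈ Set.Icc (0 : ℝ) 1) :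
    1 - ρ ≤ 1 - ρ * z ^ 2 := by
  nlinarith [mul_nonneg hρ0 (sub_nonneg.2 (pow_le_one₀ (n := 2) hz.1 hz.2))]

theorem intervalIntegrable_ellΛ_integrand {s ρ : ℝ} (hs : s ^ 2 < 1) (hρ0 : 0 ≤ ρ)
    (hρ1 : ρ < 1) :
    IntervalIntegrable
      (fun z : ℝ => 1 / ((1 - ρ * z ^ 2) * √((1 - z ^ 2) * (1 - s ^ 2 * z ^ 2))))
      MeasureTheory.volume 0 1 := by
  refine ((intervalIntegrable_ellK_integrand hs).const_mul (1 / (1 - ρ))).mono_fun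
    (Measurable.aestronglyMeasurable (by fun_prop)) ?_
  refine (MeasureTheory.ae_restrict_iff' measurableSet_uIoc).2 (.of_forall fun z hz => ?_)
  rw [Set.uIoc_of_le zero_le_one] at hz
  have hρz := one_sub_mul_sq_ge hρ0 (Set.Ioc_subset_Icc_self hz)
  have hρ : 0 < 1 - ρ := by linarith
  have hρz' : 0 < 1 - ρ * z ^ 2 := by linarith
  beta_reduce
  rw [Real.norm_of_nonneg (by positivity), Real.norm_of_nonneg (by positivity),
    ← one_div_mul_one_div]
  gcongr

/-- The logarithmic divergence of `Λ` is `1 / (1 - ρ)` times that of `K`. -/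
theorem abs_one_sub_mul_ellΛ_sub_ellK_le {s ρ : ℝ} (hs : s ^ 2 < 1) (hρ0 : 0 ≤ ρ)
    (hρ1 : ρ < 1) : |(1 - ρ) * ellΛ s ρ - ellK s| ≤ ρ / (1 - ρ) := by
  have hρ : 0 < 1 - ρ := by linarith
  rw [ellΛ, ellK, ← integral_const_mul, ← integral_sub
    ((intervalIntegrable_ellΛ_integrand hs hρ0 hρ1).const_mul _)
    (intervalIntegrable_ellK_integrand hs)]
  have key := norm_integral_le_of_norm_le_const (a := (0 : ℝ)) (b := 1) (C := ρ / (1 - ρ))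
    (f := fun z : ℝ => (1 - ρ) * (1 / ((1 - ρ * z ^ 2) * √((1 - z ^ 2) * (1 - s ^ 2 * z ^ 2))))
      - 1 / √((1 - z ^ 2) * (1 - s ^ 2 * z ^ 2))) ?_
  · simpa using key
  intro z hz
  rw [Set.uIoc_of_le zero_le_one] at hz
  have hρz := one_sub_mul_sq_ge hρ0 (Set.Ioc_subset_Icc_self hz)
  have hρz' : 0 < 1 - ρ * z ^ 2 := by linarith
  have hz2 : z ^ 2 ≤ 1 := pow_le_one₀ hz.1.le hz.2
  have hsz := one_sub_sq_le_one_sub_sq_mul_sq (s := s) (Set.Ioc_subset_Icc_self hz)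
  set A := 1 - z ^ 2 with hA
  set B := 1 - s ^ 2 * z ^ 2 with hB
  have hA0 : 0 ≤ A := by linarith
  have hB0 : 0 < B := by linarith
  have hAB : A ≤ B := by nlinarith [mul_nonneg (sub_nonneg.2 hs.le) (sq_nonneg z)]
  have hquot : A / √(A * B) ≤ 1 := by
    refine div_le_one_of_le₀ (Real.le_sqrt_of_sq_le ?_) (Real.sqrt_nonneg _)
    nlinarith
  have heq : (1 - ρ) * (1 / ((1 - ρ * z ^ 2) * √(A * B))) - 1 / √(A * B)
      = -(ρ / (1 - ρ * z ^ 2) * (A / √(A * B))) := by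
    have : (1 - ρ) = (1 - ρ * z ^ 2) - ρ * A := by rw [hA]; ring
    rw [this, ← one_div_mul_one_div]
    field_simp
    ring
  rw [heq, norm_neg, Real.norm_of_nonneg (by positivity)]
  calc ρ / (1 - ρ * z ^ 2) * (A / √(A * B)) ≤ ρ / (1 - ρ * z ^ 2) * 1 := by gcongr
    _ ≤ ρ / (1 - ρ) := by rw [mul_one]; gcongr

theorem neg_log_one_sub_div_two_le_ellK {s : ℝ} (hs0 : 0 ≤ s) (hs1 : s < 1) :
    -Real.log (1 - s) / 2 ≤ ellK s := by
  have hpos : ∀ z ∈ Set.Icc (0 : ℝ) 1, 0 < 1 - s * z := fun z hz => by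
    nlinarith [mul_le_mul_of_nonneg_left hz.2 hs0]
  have hs2 : s ^ 2 < 1 := pow_lt_one₀ hs0 hs1 two_ne_zero
  have hint : IntervalIntegrable (fun z : ℝ => s / (2 * (1 - s * z))) MeasureTheory.volume 0 1 := by
    refine ContinuousOn.intervalIntegrable_of_Icc zero_le_one ?_
    exact continuousOn_const.div (by fun_prop) fun z hz => by have := hpos z hz; positivity
  have hFTC : ∫ z in (0 : ℝ)..1, s / (2 * (1 - s * z)) = -Real.log (1 - s) / 2 := by
    rw [integral_eq_sub_of_hasDerivAt (f := fun z => -Real.log (1 - s * z) / 2) _ hint]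
    · simp
    · intro z hz
      rw [Set.uIcc_of_le zero_le_one] at hz
      have hne := (hpos z hz).ne'
      refine ((((((hasDerivAt_id z).const_mul s).const_sub 1).log hne).neg).div_const
        2).congr_deriv ?_
      simp only [id, mul_one]
      field_simp
  rw [← hFTC, ellK]
  refine integral_mono_on_of_le_Ioo zero_le_one hint (intervalIntegrable_ellK_integrand hs2)
    fun z hz => ?_
  have hz' : z ∈ Set.Icc (0 : ℝ) 1 := Set.Ioo_subset_Icc_self hz
  have h1 := hpos z hz'
  have hz2 : z ^ 2 < 1 := pow_lt_one₀ hz.1.le hz.2 two_ne_zero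
  have hB : 1 - s ^ 2 ≤ 1 - s ^ 2 * z ^ 2 := one_sub_sq_le_one_sub_sq_mul_sq hz'
  have hB0 : 0 < 1 - s ^ 2 * z ^ 2 := by linarith
  have hA0 : 0 < 1 - z ^ 2 := by linarith
  have hAB : 1 - z ^ 2 ≤ 1 - s ^ 2 * z ^ 2 := by
    nlinarith [mul_nonneg (sub_nonneg.2 hs2.le) (sq_nonneg z)]
  have hle : √((1 - z ^ 2) * (1 - s ^ 2 * z ^ 2)) ≤ 2 * (1 - s * z) := by
    calc √((1 - z ^ 2) * (1 - s ^ 2 * z ^ 2)) ≤ 1 - s ^ 2 * z ^ 2 :=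
          Real.sqrt_le_iff.2 ⟨hB0.le, by nlinarith⟩
      _ ≤ 2 * (1 - s * z) := by nlinarith [sq_nonneg (1 - s * z)]
  have hsq : 0 < √((1 - z ^ 2) * (1 - s ^ 2 * z ^ 2)) := Real.sqrt_pos.2 (by positivity)
  exact div_le_div₀ zero_le_one hs1.le hsq hle

theorem tendsto_ellK_atTop : Tendsto ellK (𝓝[<] 1) atTop := by
  have hlog : Tendsto (fun s : ℝ => -Real.log (1 - s) / 2) (𝓝[<] 1) atTop := by
    refine (tendsto_neg_atBot_atTop.comp (Real.tendsto_log_nhdsGT_zero.comp ?_)).atTop_div_const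
      two_pos
    refine tendsto_nhdsWithin_iff.2 ⟨?_, ?_⟩
    · have h : Tendsto (fun s : ℝ => 1 - s) (𝓝 1) (𝓝 (1 - 1)) :=
        Continuous.tendsto (by fun_prop) 1
      rw [sub_self] at h
      exact tendsto_nhdsWithin_of_tendsto_nhds h
    · filter_upwards [self_mem_nhdsWithin] with s hs
      exact sub_pos.2 (Set.mem_Iio.1 hs)
  refine tendsto_atTop_mono' _ ?_ hlog
  filter_upwards [Ioo_mem_nhdsLT (zero_lt_one (α := ℝ))] with s hs
  exact neg_log_one_sub_div_two_le_ellK hs.1.le hs.2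

theorem tendsto_ellΛ_div_ellK_sub_ellE {ρ : ℝ} (hρ0 : 0 ≤ ρ) (hρ1 : ρ < 1) :
    Tendsto (fun s => ellΛ s ρ / (ellK s - ellE s)) (𝓝[<] 1) (𝓝 (1 / (1 - ρ))) := by
  have hsq : ∀ᶠ s : ℝ in 𝓝[<] 1, s ^ 2 < 1 := by
    filter_upwards [Ioo_mem_nhdsLT (zero_lt_one (α := ℝ))] with s hs
    exact pow_lt_one₀ hs.1.le hs.2 two_ne_zero
  have hdiv : ∀ (f : ℝ → ℝ) (C : ℝ), (∀ s, s ^ 2 < 1 → |f s| ≤ C) →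
      Tendsto (fun s => f s / ellK s) (𝓝[<] 1) (𝓝 0) := fun f C hf =>
    tendsto_bdd_div_atTop_nhds_zero (b := -C) (B := C)
      (hsq.mono fun s hs => (abs_le.1 (hf s hs)).1)
      (hsq.mono fun s hs => (abs_le.1 (hf s hs)).2) tendsto_ellK_atTop
  have hΛ := hdiv (fun s => (1 - ρ) * ellΛ s ρ - ellK s) _
    fun s hs => abs_one_sub_mul_ellΛ_sub_ellK_le hs hρ0 hρ1
  have hE := hdiv ellE _ fun s _ => abs_ellE_le s
  have hlim := ((hΛ.const_add 1).div (hE.const_sub 1) (by norm_num)).div_const (1 - ρ)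
  simp only [add_zero, sub_zero, div_one] at hlim
  refine hlim.congr' ?_
  filter_upwards [tendsto_ellK_atTop.eventually_gt_atTop 0] with s hs
  have hρ : 1 - ρ ≠ 0 := by linarith
  have h1 : 1 + ((1 - ρ) * ellΛ s ρ - ellK s) / ellK s = (1 - ρ) * ellΛ s ρ / ellK s := by
    field_simp
    ring
  have h2 : 1 - ellE s / ellK s = (ellK s - ellE s) / ellK s := by
    field_simp
  simp only [Pi.div_apply]
  rw [h1, h2, div_div_div_cancel_right₀ hs.ne', mul_div_assoc, mul_div_cancel_left₀ _ hρ]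

/-- The modulus tends to `1` from below as the two largest Riemann invariants coalesce. -/
theorem tendsto_modulus_nhdsLT_one {ν β₂ β₃ : ℝ} (h3 : -ν < β₃) (h32 : β₃ < β₂) :
    Tendsto (fun β₁ : ℝ => √((β₁ + ν) * (β₂ - β₃) / ((β₂ + ν) * (β₁ - β₃))))
      (𝓝[>] β₂) (𝓝[<] 1) := by
  have h2 : 0 < β₂ + ν := by linarith
  have h23 : 0 < β₂ - β₃ := by linarith
  refine tendsto_nhdsWithin_iff.2 ⟨tendsto_nhdsWithin_of_tendsto_nhds ?_, ?_⟩
  · have hc : ContinuousAt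
        (fun β₁ : ℝ => √((β₁ + ν) * (β₂ - β₃) / ((β₂ + ν) * (β₁ - β₃)))) β₂ :=
      (ContinuousAt.div (by fun_prop) (by fun_prop) (by positivity)).sqrt
    have hval : √((β₂ + ν) * (β₂ - β₃) / ((β₂ + ν) * (β₂ - β₃))) = 1 := by
      rw [div_self (by positivity), Real.sqrt_one]
    simpa only [ContinuousAt, hval] using hc
  · filter_upwards [self_mem_nhdsWithin] with β₁ hβ
    have hβ' : β₂ < β₁ := hβ
    have h13 : 0 < β₁ - β₃ := by linarith
    rw [Set.mem_Iio, Real.sqrt_lt' one_pos, one_pow, div_lt_one (by positivity)]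
    nlinarith [mul_pos (sub_pos.2 hβ') (show 0 < β₃ + ν by linarith)]

/-- at the coalescence `β₁ = β₂` the third Whitham speed tends to the
Hopf characteristic speed `3β₃ + 2ν`. -/
theorem whithamC₃_tendsto_hopf_speed
    (ν β₂ β₃ : ℝ) (h3 : -ν < β₃) (h32 : β₃ < β₂) :
    Tendsto (fun β₁ : ℝ => whithamC₃ ν β₁ β₂ β₃)
      (𝓝[>] β₂) (𝓝 (3 * β₃ + 2 * ν)) := by
  have h2 : 0 < β₂ + ν := by linarith
  have h3' : 0 < β₃ + ν := by linarith
  have hρ0 : 0 ≤ (β₂ - β₃) / (β₂ + ν) := div_nonneg (by linarith) h2.le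
  have hρ1 : (β₂ - β₃) / (β₂ + ν) < 1 := by rw [div_lt_one h2]; linarith
  have hratio := (tendsto_ellΛ_div_ellK_sub_ellE hρ0 hρ1).comp (tendsto_modulus_nhdsLT_one h3 h32)
  have hid : Tendsto (fun β₁ : ℝ => β₁ + β₂ + β₃ + 2 * ν) (𝓝[>] β₂)
      (𝓝 (β₂ + β₂ + β₃ + 2 * ν)) :=
    tendsto_nhdsWithin_of_tendsto_nhds (Continuous.tendsto (by fun_prop) β₂)
  have hlim := hid.add (hratio.const_mul (2 * (β₃ + ν) * (β₃ - β₂) / (β₂ + ν)))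
  have hρ : 1 / (1 - (β₂ - β₃) / (β₂ + ν)) = (β₂ + ν) / (β₃ + ν) := by
    rw [one_sub_div h2.ne', one_div_div]
    congr 1
    ring
  have hval : β₂ + β₂ + β₃ + 2 * ν + 2 * (β₃ + ν) * (β₃ - β₂) / (β₂ + ν)
      * (1 / (1 - (β₂ - β₃) / (β₂ + ν))) = 3 * β₃ + 2 * ν := by
    rw [hρ]
    field_simp
    ring
  rw [hval] at hlim
  refine hlim.congr fun β₁ => ?_
  simp only [whithamC₃, Function.comp_apply, div_mul_div_comm]
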